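/- arXiv:2605.09775 — 5 statements merged into one kernel-verified Lean document; each statement's English description precedes it below -/
import Mathlib

section
/- Let W, Y and Z be real Hilbert spaces, A : W → Z and B : Y → W bounded linear operators, and λ > 0. Then the operator B*B − B*A*(AA* + λI)⁻¹AB on Y is positive, i.e., it is self-adjoint and ⟨y, (B*B − B*A*(AA* + λI)⁻¹AB) y⟩ ≥ 0 for every y ∈ Y. -/
open ContinuousLinearMap

section RegularizedGram

variable {W Z : Type*}
  [NormedAddCommGroup W] [InnerProductSpace ℝ W] [CompleteSpace W]
  [NormedAddCommGroup Z] [InnerProductSpace ℝ Z] [CompleteSpace Z]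

lemma isSelfAdjoint_comp_adjoint_add_smul (A : W →L[ℝ] Z) (c : ℝ) :
    IsSelfAdjoint (A.comp (adjoint A) + c • (1 : Z →L[ℝ] Z)) := by
  rw [isSelfAdjoint_iff']
  simp [adjoint_comp, ← star_eq_adjoint (1 : Z →L[ℝ] Z)]

lemma inner_comp_adjoint_add_smul_self (A : W →L[ℝ] Z) (c : ℝ) (z : Z) :
    inner ℝ ((A.comp (adjoint A) + c • (1 : Z →L[ℝ] Z)) z) z =
      ‖adjoint A z‖ ^ 2 + c * ‖z‖ ^ 2 := by
  simp [inner_add_left, real_inner_smul_left, ← adjoint_inner_right]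

lemma isUnit_comp_adjoint_add_smul (A : W →L[ℝ] Z) {c : ℝ} (hc : 0 < c) :
    IsUnit (A.comp (adjoint A) + c • (1 : Z →L[ℝ] Z)) := by
  refine isUnit_of_forall_le_norm_inner_map _ (c := .mk c hc.le) hc fun z ↦ ?_
  rw [inner_comp_adjoint_add_smul_self, NNReal.coe_mk, mul_comm]
  exact (le_add_of_nonneg_left (by positivity)).trans (le_abs_self _)

/-- The operator `I − A*(AA* + cI)⁻¹A` is positive. -/
lemma isPositive_one_sub_adjoint_comp_inverse_comp (A : W →L[ℝ] Z) {c : ℝ} (hc : 0 < c) :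
    (1 - (adjoint A).comp
      ((Ring.inverse (A.comp (adjoint A) + c • (1 : Z →L[ℝ] Z))).comp A)).IsPositive := by
  have hself := isSelfAdjoint_comp_adjoint_add_smul A c
  have hunit := isUnit_comp_adjoint_add_smul A hc
  have hinner := inner_comp_adjoint_add_smul_self A c
  set S := A.comp (adjoint A) + c • (1 : Z →L[ℝ] Z)
  have hinv : adjoint (Ring.inverse S) = Ring.inverse S := hself.ringInverse.adjoint_eq
  refine isPositive_def'.2 ⟨?_, fun w ↦ ?_⟩
  · rw [isSelfAdjoint_iff']
    simp [adjoint_comp, hinv, ← star_eq_adjoint (1 : W →L[ℝ] W), comp_assoc]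
  · set u := Ring.inverse S (A w)
    have hu : S u = A w := DFunLike.congr_fun (Ring.mul_inverse_cancel S hunit) (A w)
    have huw : inner ℝ (adjoint A u) w = ‖adjoint A u‖ ^ 2 + c * ‖u‖ ^ 2 := by
      rw [adjoint_inner_left, ← hu, real_inner_comm, hinner]
    have hsq := norm_sub_sq_real w (adjoint A u)
    rw [real_inner_comm, huw] at hsq
    have hval : reApplyInnerSelf
        (1 - (adjoint A).comp ((Ring.inverse S).comp A)) w =
          ‖w‖ ^ 2 - inner ℝ (adjoint A u) w := by
      simp [reApplyInnerSelf_apply, inner_sub_left, u]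
    rw [hval, huw]
    nlinarith [sq_nonneg ‖w - adjoint A u‖, mul_nonneg hc.le (sq_nonneg ‖u‖)]

end RegularizedGram

/-- the posterior variance operator `B*B − B*A*(AA* + λI)⁻¹AB` is positive. -/
theorem stmt3
    {W Y Z : Type*}
    [NormedAddCommGroup W] [InnerProductSpace ℝ W] [CompleteSpace W]
    [NormedAddCommGroup Y] [InnerProductSpace ℝ Y] [CompleteSpace Y]
    [NormedAddCommGroup Z] [InnerProductSpace ℝ Z] [CompleteSpace Z]
    (A : W →L[ℝ] Z) (B : Y →L[ℝ] W) (lam : ℝ) (hlam : 0 < lam) :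
    IsSelfAdjoint ((adjoint B).comp B -
        (adjoint B).comp ((adjoint A).comp
          ((Ring.inverse (A.comp (adjoint A) + lam • (1 : Z →L[ℝ] Z))).comp (A.comp B)))) ∧
    ∀ y : Y, 0 ≤ inner (𝕜 := ℝ) y
        (((adjoint B).comp B -
          (adjoint B).comp ((adjoint A).comp
            ((Ring.inverse (A.comp (adjoint A) + lam • (1 : Z →L[ℝ] Z))).comp (A.comp B)))) y) := by
  have h := (isPositive_one_sub_adjoint_comp_inverse_comp A hlam).adjoint_conj B
  have heq : (adjoint B) ∘L (1 - (adjoint A).comp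
      ((Ring.inverse (A.comp (adjoint A) + lam • (1 : Z →L[ℝ] Z))).comp A)) ∘L B =
      (adjoint B).comp B - (adjoint B).comp ((adjoint A).comp
        ((Ring.inverse (A.comp (adjoint A) + lam • (1 : Z →L[ℝ] Z))).comp (A.comp B))) := by
    ext y
    simp
  rw [heq] at h
  exact ⟨h.isSelfAdjoint, h.inner_nonneg_right⟩
end

section
/- Let W, Y and Z be real Hilbert spaces, A : W → Z and B : Y → W bounded linear operators, λ > 0, w ∈ W, and δ ∈ Z. Let μ := A*(AA* + λI)⁻¹(Aw + δ). Then ‖B*μ − B*w‖_Y ≤ λ^{-1/2} · ‖λ B*(A*A + λI)⁻¹B‖_op^{1/2} · ( ⟨A*δ, (A*A + λI)⁻¹ A*δ⟩^{1/2} + λ^{1/2}‖w‖_W ), where ‖·‖_op denotes the operator norm and the square roots on scalars are real square roots. -/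
open ContinuousLinearMap

/-- Cauchy-Schwarz inequality for the semi-inner product given by a positive operator. -/
lemma ContinuousLinearMap.IsPositive.inner_sq_le
    {E : Type*} [NormedAddCommGroup E] [InnerProductSpace ℝ E] {S : E →L[ℝ] E} (hS : S.IsPositive) (x y : E) :
    inner ℝ x (S y) ^ 2 ≤ inner ℝ x (S x) * inner ℝ y (S y) := by
  have h := LinearMap.BilinForm.apply_mul_apply_le_of_forall_zero_le
    ((innerₗ E).compl₂ (S : E →ₗ[ℝ] E)) (fun z ↦ by simpa using hS.inner_nonneg_right z) x y
  have hsymm : inner ℝ y (S x) = inner ℝ x (S y) := by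
    rw [real_inner_comm]
    exact hS.isSymmetric x y
  simpa [hsymm, ← sq] using h

section RegularizedInverse

variable {E F G : Type*}
  [NormedAddCommGroup E] [InnerProductSpace ℝ E] [CompleteSpace E]
  [NormedAddCommGroup F] [InnerProductSpace ℝ F] [CompleteSpace F]
  [NormedAddCommGroup G] [InnerProductSpace ℝ G] [CompleteSpace G]

/-- A positive operator `S` satisfies `‖B* S v‖ ≤ ‖B* S B‖^(1/2) ⟪v, S v⟫^(1/2)`. -/
lemma ContinuousLinearMap.IsPositive.norm_adjoint_apply_le {S : E →L[ℝ] E} (hS : S.IsPositive)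
    (B : F →L[ℝ] E) (v : E) :
    ‖adjoint B (S v)‖ ≤ √‖(adjoint B).comp (S.comp B)‖ * √(inner ℝ v (S v)) := by
  set M := (adjoint B).comp (S.comp B) with hM
  set u := adjoint B (S v) with hu
  have hcs : (‖u‖ ^ 2) ^ 2 ≤ inner ℝ (B u) (S (B u)) * inner ℝ v (S v) := by
    have h := hS.inner_sq_le (B u) v
    rwa [← adjoint_inner_right, ← hu, real_inner_self_eq_norm_sq] at h
  have hop : inner ℝ (B u) (S (B u)) ≤ ‖M‖ * ‖u‖ ^ 2 := by
    calc inner ℝ (B u) (S (B u)) = inner ℝ u (M u) := (adjoint_inner_right B u (S (B u))).symm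
      _ ≤ ‖u‖ * ‖M u‖ := real_inner_le_norm _ _
      _ ≤ ‖u‖ * (‖M‖ * ‖u‖) := by gcongr; exact M.le_opNorm u
      _ = ‖M‖ * ‖u‖ ^ 2 := by ring
  have hv : 0 ≤ inner ℝ v (S v) := hS.inner_nonneg_right v
  rw [← Real.sqrt_mul (norm_nonneg _)]
  apply Real.le_sqrt_of_sq_le
  rcases eq_or_ne u 0 with h0 | h0
  · rw [h0]
    simpa using mul_nonneg (norm_nonneg M) hv
  · have hpos : 0 < ‖u‖ ^ 2 := by positivity
    refine le_of_mul_le_mul_left ?_ hpos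
    calc ‖u‖ ^ 2 * ‖u‖ ^ 2 = (‖u‖ ^ 2) ^ 2 := by ring
      _ ≤ inner ℝ (B u) (S (B u)) * inner ℝ v (S v) := hcs
      _ ≤ ‖M‖ * ‖u‖ ^ 2 * inner ℝ v (S v) := by gcongr
      _ = ‖u‖ ^ 2 * (‖M‖ * inner ℝ v (S v)) := by ring

lemma inner_adjoint_comp_self_add_smul_one (A : E →L[ℝ] G) (c : ℝ) (x y : E) :
    inner ℝ (((adjoint A).comp A + c • (1 : E →L[ℝ] E)) x) y
      = inner ℝ (A x) (A y) + c * inner ℝ x y := by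
  simp [inner_add_left, inner_smul_left, adjoint_inner_left]

lemma isUnit_adjoint_comp_self_add_smul_one (A : E →L[ℝ] G) {c : ℝ} (hc : 0 < c) :
    IsUnit ((adjoint A).comp A + c • (1 : E →L[ℝ] E)) := by
  refine isUnit_of_forall_le_norm_inner_map _ (c := ⟨c, hc.le⟩) hc fun x ↦ ?_
  rw [inner_adjoint_comp_self_add_smul_one, real_inner_self_eq_norm_sq,
    real_inner_self_eq_norm_sq, Real.norm_of_nonneg (by positivity)]
  change ‖x‖ ^ 2 * c ≤ _
  nlinarith [sq_nonneg ‖A x‖]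

lemma isUnit_comp_adjoint_self_add_smul_one (A : E →L[ℝ] G) {c : ℝ} (hc : 0 < c) :
    IsUnit (A.comp (adjoint A) + c • (1 : G →L[ℝ] G)) := by
  simpa using isUnit_adjoint_comp_self_add_smul_one (adjoint A) hc

lemma inner_inverse_adjoint_comp_self_add_smul_one (A : E →L[ℝ] G) {c : ℝ} (hc : 0 < c)
    (x y : E) :
    let S := Ring.inverse ((adjoint A).comp A + c • (1 : E →L[ℝ] E))
    inner ℝ x (S y) = inner ℝ (A (S x)) (A (S y)) + c * inner ℝ (S x) (S y) := by
  intro S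
  have h := DFunLike.congr_fun
    (Ring.mul_inverse_cancel _ (isUnit_adjoint_comp_self_add_smul_one A hc)) x
  rw [← inner_adjoint_comp_self_add_smul_one]
  exact congrArg (fun z ↦ inner ℝ z (S y)) h.symm

lemma isPositive_inverse_adjoint_comp_self_add_smul_one (A : E →L[ℝ] G) {c : ℝ} (hc : 0 < c) :
    (Ring.inverse ((adjoint A).comp A + c • (1 : E →L[ℝ] E))).IsPositive := by
  have key := inner_inverse_adjoint_comp_self_add_smul_one A hc
  set S := Ring.inverse ((adjoint A).comp A + c • (1 : E →L[ℝ] E))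
  have hsymm (x y : E) : inner ℝ (S x) y = inner ℝ x (S y) := by
    rw [real_inner_comm, key y x, key x y, real_inner_comm (A (S x)), real_inner_comm (S x)]
  refine ⟨hsymm, fun x ↦ ?_⟩
  change 0 ≤ inner ℝ (S x) x
  rw [hsymm, key, real_inner_self_eq_norm_sq, real_inner_self_eq_norm_sq]
  positivity

lemma mul_inner_inverse_adjoint_comp_self_add_smul_one_le (A : E →L[ℝ] G) {c : ℝ} (hc : 0 < c)
    (x : E) :
    c * inner ℝ x (Ring.inverse ((adjoint A).comp A + c • (1 : E →L[ℝ] E)) x) ≤ ‖x‖ ^ 2 := by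
  have key := inner_inverse_adjoint_comp_self_add_smul_one A hc x x
  set S := Ring.inverse ((adjoint A).comp A + c • (1 : E →L[ℝ] E))
  simp only [real_inner_self_eq_norm_sq] at key
  have h := norm_sub_sq_real x (c • S x)
  rw [inner_smul_right, norm_smul, Real.norm_of_nonneg hc.le] at h
  have h1 : c * ‖S x‖ ^ 2 ≤ inner ℝ x (S x) := by
    rw [key]
    exact le_add_of_nonneg_left (sq_nonneg _)
  nlinarith [sq_nonneg ‖x - c • S x‖, mul_le_mul_of_nonneg_left h1 hc.le]

/-- The push-through identity `A* (A A* + c)⁻¹ = (A* A + c)⁻¹ A*`. -/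
lemma adjoint_inverse_comp_adjoint_self_add_smul_one (A : E →L[ℝ] G) {c : ℝ} (hc : 0 < c)
    (z : G) :
    adjoint A (Ring.inverse (A.comp (adjoint A) + c • (1 : G →L[ℝ] G)) z)
      = Ring.inverse ((adjoint A).comp A + c • (1 : E →L[ℝ] E)) (adjoint A z) := by
  have hl := Ring.inverse_mul_cancel _ (isUnit_adjoint_comp_self_add_smul_one A hc)
  have hr := DFunLike.congr_fun
    (Ring.mul_inverse_cancel _ (isUnit_comp_adjoint_self_add_smul_one A hc)) z
  set R := Ring.inverse (A.comp (adjoint A) + c • (1 : G →L[ℝ] G))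
  set S := Ring.inverse ((adjoint A).comp A + c • (1 : E →L[ℝ] E))
  have hz : A (adjoint A (R z)) + c • R z = z := hr
  have hl' := DFunLike.congr_fun hl (adjoint A (R z))
  have hS : S (adjoint A (A (adjoint A (R z))) + c • adjoint A (R z)) = adjoint A (R z) := hl'
  rw [← hS]
  conv_rhs => rw [← hz]
  simp only [map_add, map_smul]

end RegularizedInverse

/-- deterministic core of the concentration bound (Theorem 1). -/
theorem stmt5
    {W Y Z : Type*}
    [NormedAddCommGroup W] [InnerProductSpace ℝ W] [CompleteSpace W]
    [NormedAddCommGroup Y] [InnerProductSpace ℝ Y] [CompleteSpace Y]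
    [NormedAddCommGroup Z] [InnerProductSpace ℝ Z] [CompleteSpace Z]
    (A : W →L[ℝ] Z) (B : Y →L[ℝ] W) (lam : ℝ) (hlam : 0 < lam) (w : W) (δ : Z)
    (μ : W)
    (hμ : μ = (adjoint A)
        ((Ring.inverse (A.comp (adjoint A) + lam • (1 : Z →L[ℝ] Z))) (A w + δ))) :
    ‖(adjoint B) μ - (adjoint B) w‖ ≤
      Real.sqrt lam⁻¹ *
      Real.sqrt ‖lam • ((adjoint B).comp
          ((Ring.inverse ((adjoint A).comp A + lam • (1 : W →L[ℝ] W))).comp B))‖ *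
      (Real.sqrt (inner (𝕜 := ℝ) ((adjoint A) δ)
            ((Ring.inverse ((adjoint A).comp A + lam • (1 : W →L[ℝ] W))) ((adjoint A) δ)))
        + Real.sqrt lam * ‖w‖) := by
  have hpos := isPositive_inverse_adjoint_comp_self_add_smul_one A hlam
  have hw := mul_inner_inverse_adjoint_comp_self_add_smul_one_le A hlam w
  have hSw := DFunLike.congr_fun
    (Ring.inverse_mul_cancel _ (isUnit_adjoint_comp_self_add_smul_one A hlam)) w
  rw [adjoint_inverse_comp_adjoint_self_add_smul_one A hlam] at hμ
  set S := Ring.inverse ((adjoint A).comp A + lam • (1 : W →L[ℝ] W))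
  replace hSw : S (adjoint A (A w) + lam • w) = w := hSw
  have herr : adjoint B μ - adjoint B w
      = adjoint B (S (adjoint A δ)) - lam • adjoint B (S w) := by
    rw [← map_smul, ← map_smul, ← map_sub, ← map_sub, hμ]
    have hSw' : S (adjoint A (A w)) = w - lam • S w := by
      rw [eq_sub_iff_add_eq, ← map_smul, ← map_add, hSw]
    congr 1
    rw [map_add, map_add, hSw', map_smul]
    abel
  have hscale : √lam⁻¹ * √‖lam • (adjoint B).comp (S.comp B)‖
      = √‖(adjoint B).comp (S.comp B)‖ := by
    rw [norm_smul, Real.norm_of_nonneg hlam.le, ← Real.sqrt_mul (inv_nonneg.2 hlam.le),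
      inv_mul_cancel_left₀ hlam.ne']
  have hbias : lam * √(inner ℝ w (S w)) ≤ √lam * ‖w‖ := by
    calc lam * √(inner ℝ w (S w)) = √lam * √(lam * inner ℝ w (S w)) := by
          rw [Real.sqrt_mul hlam.le, ← mul_assoc, Real.mul_self_sqrt hlam.le]
      _ ≤ √lam * ‖w‖ := by
          gcongr
          exact Real.sqrt_le_iff.2 ⟨norm_nonneg w, hw⟩
  rw [herr, hscale]
  calc ‖adjoint B (S (adjoint A δ)) - lam • adjoint B (S w)‖
      ≤ ‖adjoint B (S (adjoint A δ))‖ + lam * ‖adjoint B (S w)‖ := by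
        refine (norm_sub_le _ _).trans_eq ?_
        rw [norm_smul, Real.norm_of_nonneg hlam.le]
    _ ≤ √‖(adjoint B).comp (S.comp B)‖ * √(inner ℝ (adjoint A δ) (S (adjoint A δ)))
        + lam * (√‖(adjoint B).comp (S.comp B)‖ * √(inner ℝ w (S w))) := by
        gcongr <;> exact hpos.norm_adjoint_apply_le B _
    _ = √‖(adjoint B).comp (S.comp B)‖ * (√(inner ℝ (adjoint A δ) (S (adjoint A δ)))
        + lam * √(inner ℝ w (S w))) := by ring
    _ ≤ _ := by gcongr
end

section
/- Let H, Y and M be real Hilbert spaces, t ≥ 1, Φ₁,…,Φ_t : Y → H bounded linear operators, M̂ : Y → M a bounded linear operator, y₁,…,y_t ∈ M, and λ > 0. Define the regularized loss L(w) := Σ_{i=1}^t ‖M̂ Φᵢ* w − yᵢ‖²_M + λ‖w‖²_H for w ∈ H. Suppose α₁,…,α_t ∈ M satisfy the linear system Σ_{j=1}^t M̂ Φᵢ* Φⱼ M̂* αⱼ + λ αᵢ = yᵢ for every i ∈ {1,…,t}, and set w₀ := Σ_{i=1}^t Φᵢ M̂* αᵢ. Then for every g ∈ H, L(w₀ + g)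 = L(w₀) + Σ_{i=1}^t ‖M̂ Φᵢ* g‖²_M + λ‖g‖²_H; in particular w₀ is the unique minimizer of L over H. -/
open ContinuousLinearMap

/-- At a solution of the normal equations, the regularized least-squares loss differs from its
value at a translate by the quadratic form of the translation. -/
theorem sum_norm_sub_sq_add_mul_norm_sq_of_normal_eq {ι H M : Type*} [Fintype ι]
    [NormedAddCommGroup H] [InnerProductSpace ℝ H] [CompleteSpace H]
    [NormedAddCommGroup M] [InnerProductSpace ℝ M] [CompleteSpace M]
    (A : ι → H →L[ℝ] M) (y : ι → M) (c : ℝ) {w : H}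
    (hw : ∑ i, adjoint (A i) (A i w - y i) + c • w = 0) (g : H) :
    ∑ i, ‖A i (w + g) - y i‖ ^ 2 + c * ‖w + g‖ ^ 2 =
      (∑ i, ‖A i w - y i‖ ^ 2 + c * ‖w‖ ^ 2) + ∑ i, ‖A i g‖ ^ 2 + c * ‖g‖ ^ 2 := by
  have hcross : ∑ i, inner ℝ (A i w - y i) (A i g) + c * inner ℝ w g = 0 := by
    have h := congrArg (fun v => inner ℝ v g) hw
    simpa only [inner_add_left, sum_inner, adjoint_inner_left, real_inner_smul_left,
      inner_zero_left] using h
  have hterm (i : ι) : ‖A i (w + g) - y i‖ ^ 2 =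
      ‖A i w - y i‖ ^ 2 + 2 * inner ℝ (A i w - y i) (A i g) + ‖A i g‖ ^ 2 := by
    rw [map_add, add_sub_right_comm, norm_add_sq_real]
  simp only [hterm, norm_add_sq_real w g, Finset.sum_add_distrib, ← Finset.mul_sum]
  linear_combination 2 * hcross

/-- representer lemma for vector-valued KRR with a measurement operator. -/
theorem stmt7
    {H Y M : Type*}
    [NormedAddCommGroup H] [InnerProductSpace ℝ H] [CompleteSpace H]
    [NormedAddCommGroup Y] [InnerProductSpace ℝ Y] [CompleteSpace Y]
    [NormedAddCommGroup M] [InnerProductSpace ℝ M] [CompleteSpace M]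
    (t : ℕ) (ht : 1 ≤ t)
    (Φ : Fin t → (Y →L[ℝ] H)) (Mhat : Y →L[ℝ] M)
    (y : Fin t → M) (lam : ℝ) (hlam : 0 < lam)
    (L : H → ℝ)
    (hL : ∀ w : H, L w = ∑ i : Fin t, ‖Mhat ((adjoint (Φ i)) w) - y i‖ ^ 2 + lam * ‖w‖ ^ 2)
    (α : Fin t → M)
    (hα : ∀ i : Fin t,
      (∑ j : Fin t, Mhat ((adjoint (Φ i)) ((Φ j) ((adjoint Mhat) (α j))))) + lam • α i = y i)
    (w₀ : H) (hw₀ : w₀ = ∑ i : Fin t, (Φ i) ((adjoint Mhat) (α i))) :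
    (∀ g : H,
      L (w₀ + g) = L w₀ + ∑ i : Fin t, ‖Mhat ((adjoint (Φ i)) g)‖ ^ 2 + lam * ‖g‖ ^ 2) ∧
    (∀ w : H, w ≠ w₀ → L w₀ < L w) := by
  have hres (i : Fin t) : Mhat (adjoint (Φ i) w₀) - y i = -(lam • α i) := by
    simp only [← hα i, hw₀, map_sum]
    abel
  have hnormal : ∑ i, adjoint (Mhat ∘L adjoint (Φ i)) ((Mhat ∘L adjoint (Φ i)) w₀ - y i) +
      lam • w₀ = 0 := by
    simp only [adjoint_comp, adjoint_adjoint, comp_apply, hres, map_neg, map_smul,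
      Finset.sum_neg_distrib, ← Finset.smul_sum, ← hw₀, neg_add_cancel]
  have hexpand (g : H) :
      L (w₀ + g) = L w₀ + ∑ i : Fin t, ‖Mhat ((adjoint (Φ i)) g)‖ ^ 2 + lam * ‖g‖ ^ 2 := by
    simpa only [hL, comp_apply] using sum_norm_sub_sq_add_mul_norm_sq_of_normal_eq
      (fun i => Mhat ∘L adjoint (Φ i)) y lam hnormal g
  refine ⟨hexpand, fun w hw => ?_⟩
  have hg : 0 < ‖w - w₀‖ := norm_pos_iff.mpr (sub_ne_zero.mpr hw)
  have hsum : 0 ≤ ∑ i : Fin t, ‖Mhat ((adjoint (Φ i)) (w - w₀))‖ ^ 2 := by positivity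
  have hpen : 0 < lam * ‖w - w₀‖ ^ 2 := by positivity
  have h := hexpand (w - w₀)
  rw [add_sub_cancel] at h
  linarith
end

section
/- Let X be a nonempty set, T ≥ 1 an integer, F : X → ℝ, and for each t ∈ {0,…,T−1} let μ_t : X → ℝ and σ_t : X → ℝ with σ_t(x) ≥ 0 for all x, and let β₀ ≤ β₁ ≤ … ≤ β_T be nonnegative reals. Let x* ∈ X and x₁,…,x_T ∈ X. Assume: (i) for every t ∈ {1,…,T} and every x ∈ X, |F(x) − μ_{t−1}(x)| ≤ β_{t−1} σ_{t−1}(x); and (ii) for every t ∈ {1,…,T} and every x ∈ X, μ_{t−1}(x) + β_{t−1}σ_{t−1}(x) ≤ μ_{t−1}(x_t) + β_{t−1}σ_{t−1}(x_t). Then Σ_{t=1}^T (F(x*) − F(x_t)) ≤ 2 β_T √( T · Σ_{t=1}^T σ_{t−1}(x_t)² ). -/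
/-- deterministic regret bound for the UCB rule (core of Theorem 2). -/
theorem stmt9
    {X : Type*} [Nonempty X]
    (T : ℕ) (hT : 1 ≤ T)
    (F : X → ℝ) (μ : ℕ → X → ℝ) (σ : ℕ → X → ℝ)
    (hσ : ∀ t, t ≤ T - 1 → ∀ x : X, 0 ≤ σ t x)
    (β : ℕ → ℝ)
    (hβ0 : 0 ≤ β 0)
    (hβmono : ∀ i j, i ≤ j → j ≤ T → β i ≤ β j)
    (xstar : X) (x : ℕ → X)
    (hconf : ∀ t, 1 ≤ t → t ≤ T → ∀ x' : X,
      |F x' - μ (t - 1) x'| ≤ β (t - 1) * σ (t - 1) x')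
    (hucb : ∀ t, 1 ≤ t → t ≤ T → ∀ x' : X,
      μ (t - 1) x' + β (t - 1) * σ (t - 1) x' ≤
        μ (t - 1) (x t) + β (t - 1) * σ (t - 1) (x t)) :
    ∑ t ∈ Finset.Icc 1 T, (F xstar - F (x t)) ≤
      2 * β T * Real.sqrt ((T : ℝ) * ∑ t ∈ Finset.Icc 1 T, (σ (t - 1) (x t)) ^ 2) := by
  have hβT : 0 ≤ β T := hβ0.trans (hβmono 0 T (Nat.zero_le T) le_rfl)
  have instantaneous_regret : ∀ t ∈ Finset.Icc 1 T,
      F xstar - F (x t) ≤ 2 * β T * σ (t - 1) (x t) := by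
    intro t ht
    obtain ⟨h1, h2⟩ := Finset.mem_Icc.mp ht
    have hstar := (abs_le.mp (hconf t h1 h2 xstar)).2
    have ht := (abs_le.mp (hconf t h1 h2 (x t))).1
    have hmax := hucb t h1 h2 xstar
    have hβσ : β (t - 1) * σ (t - 1) (x t) ≤ β T * σ (t - 1) (x t) :=
      mul_le_mul_of_nonneg_right (hβmono (t - 1) T (by omega) le_rfl)
        (hσ (t - 1) (by omega) (x t))
    linarith
  have cauchy_schwarz : ∑ t ∈ Finset.Icc 1 T, σ (t - 1) (x t) ≤
      Real.sqrt ((T : ℝ) * ∑ t ∈ Finset.Icc 1 T, (σ (t - 1) (x t)) ^ 2) := by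
    apply Real.le_sqrt_of_sq_le
    simpa using sq_sum_le_card_mul_sum_sq (s := Finset.Icc 1 T) (f := fun t => σ (t - 1) (x t))
  calc ∑ t ∈ Finset.Icc 1 T, (F xstar - F (x t))
      ≤ ∑ t ∈ Finset.Icc 1 T, 2 * β T * σ (t - 1) (x t) := Finset.sum_le_sum instantaneous_regret
    _ = 2 * β T * ∑ t ∈ Finset.Icc 1 T, σ (t - 1) (x t) := by rw [Finset.mul_sum]
    _ ≤ _ := mul_le_mul_of_nonneg_left cauchy_schwarz (by positivity)
end

section
/- Let t ≥ 1 and n ≥ 1, let λ > 0, and let K be a real symmetric positive-semidefinite matrix indexed by Fin t × Fin n, viewed as a t × t array of n × n blocks K_{ab} (a, b ∈ {1,…,t}). For i ∈ {2,…,t}, let K^{(i−1)} denote the leading principal block submatrix formed by the blocks K_{ab} with a, b ≤ i−1, let k_i denote the (i−1)n × n matrix formed by stacking the blocks K_{1i},…,K_{i−1,i}, and define the posterior block P_i := K_{ii} − k_iᵀ (K^{(i−1)} + λI)⁻¹ k_i, with P₁ := K_{11}. Then det(I + λ⁻¹ K) = ∏_{i=1}^t det(I_n + λ⁻¹ P_i).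 -/
open Matrix

/-- Schur complement formula for the determinant of a regularized symmetric block matrix. -/
theorem det_one_add_inv_smul_fromBlocks {m n : Type*} [Fintype m] [Fintype n] [DecidableEq m]
    [DecidableEq n] {lam : ℝ} (hlam : 0 < lam) {A : Matrix m m ℝ} (hA : A.PosSemidef)
    (B : Matrix m n ℝ) (D : Matrix n n ℝ) :
    (1 + lam⁻¹ • fromBlocks A B Bᵀ D).det =
      (1 + lam⁻¹ • A).det *
        (1 + lam⁻¹ • (D - Bᵀ * (A + lam • (1 : Matrix m m ℝ))⁻¹ * B)).det := by
  have hne : lam ≠ 0 := hlam.ne'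
  have hpos : (A + lam • (1 : Matrix m m ℝ)).PosDef :=
    PosDef.posSemidef_add hA (PosDef.one.smul hlam)
  have hdet : IsUnit (A + lam • (1 : Matrix m m ℝ)).det := hpos.det_pos.ne'.isUnit
  have hfac : 1 + lam⁻¹ • A = lam⁻¹ • (A + lam • (1 : Matrix m m ℝ)) := by
    rw [smul_add, smul_smul, inv_mul_cancel₀ hne, one_smul, add_comm]
  have hinv : (1 + lam⁻¹ • A) * (lam • (A + lam • (1 : Matrix m m ℝ))⁻¹) = 1 := by
    rw [hfac, smul_mul_smul_comm, inv_mul_cancel₀ hne, one_smul, mul_nonsing_inv _ hdet]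
  let : Invertible (1 + lam⁻¹ • A) := invertibleOfRightInverse _ _ hinv
  have hinvOf : ⅟(1 + lam⁻¹ • A) = lam • (A + lam • (1 : Matrix m m ℝ))⁻¹ :=
    invOf_eq_right_inv hinv
  have hblocks : 1 + lam⁻¹ • fromBlocks A B Bᵀ D =
      fromBlocks (1 + lam⁻¹ • A) (lam⁻¹ • B) (lam⁻¹ • Bᵀ) (1 + lam⁻¹ • D) := by
    rw [← fromBlocks_one, fromBlocks_smul, fromBlocks_add, zero_add, zero_add]
  rw [hblocks, det_fromBlocks₁₁, hinvOf]
  congr 2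
  simp only [Matrix.smul_mul, Matrix.mul_smul, smul_smul, mul_inv_cancel₀ hne, one_smul,
    smul_sub, add_sub_assoc]

/-- Splitting off the last block of a block index. -/
noncomputable def lastBlockEquiv (t n : ℕ) : (Fin t × Fin n) ⊕ Fin n ≃ Fin (t + 1) × Fin n :=
  Equiv.ofBijective (Sum.elim (fun p => (p.1.castSucc, p.2)) fun q => (Fin.last t, q)) <| by
    constructor
    · rintro (⟨a, p⟩ | p) (⟨b, q⟩ | q) h
      · simpa using h
      · exact absurd (congrArg Prod.fst h) (Fin.castSucc_lt_last a).ne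
      · exact absurd (congrArg Prod.fst h) (Fin.castSucc_lt_last b).ne'
      · simpa using h
    · rintro ⟨i, q⟩
      refine Fin.lastCases ⟨Sum.inr q, rfl⟩ (fun a => ⟨Sum.inl (a, q), rfl⟩) i

/-- block-Cholesky decomposition of the regularized determinant:
`det(I + λ⁻¹K) = ∏ᵢ det(Iₙ + λ⁻¹ Pᵢ)`, where `Pᵢ` is the posterior block of the `i`-th
block given the preceding ones (for the first block, `P₁ = K₁₁`). -/
theorem stmt10
    (t n : ℕ) (ht : 1 ≤ t) (hn : 1 ≤ n)
    (lam : ℝ) (hlam : 0 < lam)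
    (K : Matrix (Fin t × Fin n) (Fin t × Fin n) ℝ) (hK : K.PosSemidef) :
    (1 + lam⁻¹ • K).det =
      ∏ i : Fin t,
        (1 + lam⁻¹ •
          ((Matrix.of fun p q : Fin n => K (i, p) (i, q)) -
            (Matrix.of fun (ap : Fin i.val × Fin n) (q : Fin n) =>
                K (Fin.castLE i.isLt.le ap.1, ap.2) (i, q))ᵀ *
              ((Matrix.of fun (ap bq : Fin i.val × Fin n) =>
                  K (Fin.castLE i.isLt.le ap.1, ap.2) (Fin.castLE i.isLt.le bq.1, bq.2)) +
                lam • (1 : Matrix (Fin i.val × Fin n) (Fin i.val × Fin n) ℝ))⁻¹ *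
              (Matrix.of fun (ap : Fin i.val × Fin n) (q : Fin n) =>
                K (Fin.castLE i.isLt.le ap.1, ap.2) (i, q)))).det := by
  clear ht hn
  induction t with
  | zero => simp [det_isEmpty]
  | succ t ih =>
    have hA : (K.submatrix (fun p : Fin t × Fin n => (p.1.castSucc, p.2))
        fun p : Fin t × Fin n => (p.1.castSucc, p.2)).PosSemidef := hK.submatrix _
    have hsplit : (1 + lam⁻¹ • K).submatrix (lastBlockEquiv t n) (lastBlockEquiv t n) =
        1 + lam⁻¹ • fromBlocks
          (K.submatrix (fun p : Fin t × Fin n => (p.1.castSucc, p.2))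
            fun p : Fin t × Fin n => (p.1.castSucc, p.2))
          (of fun (p : Fin t × Fin n) (q : Fin n) => K (p.1.castSucc, p.2) (Fin.last t, q))
          (of fun (p : Fin t × Fin n) (q : Fin n) => K (p.1.castSucc, p.2) (Fin.last t, q))ᵀ
          (of fun p q : Fin n => K (Fin.last t, p) (Fin.last t, q)) := by
      rw [submatrix_add, submatrix_smul, Pi.add_apply, Pi.add_apply, submatrix_one_equiv]
      congr 2
      ext (p | p) (q | q)
      · rfl
      · rfl
      · exact congrArg (lam⁻¹ * ·)
          (hK.isHermitian.apply (Fin.last t, p) (q.1.castSucc, q.2)).symm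
      · rfl
    rw [← det_submatrix_equiv_self (lastBlockEquiv t n), hsplit,
      det_one_add_inv_smul_fromBlocks hlam hA, ih _ hA, Fin.prod_univ_castSucc]
    rfl
end
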